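/- For every integer c ≥ 7, if v is a vertex of a c-PCF-critical graph G and v has at least one neighbor of degree 2, then 2·deg(v) ≥ n₂(v) + n₃(v) + c. -/

import Mathlib

open SimpleGraph

/-- A proper conflict-free coloring with colors in `Fin c`. -/
def IsPCFColoring {V : Type*} {c : ℕ} (G : SimpleGraph V) (f : V → Fin c) : Prop :=
  (∀ ⦃u v : V⦄, G.Adj u v → f u ≠ f v) ∧
  ∀ v : V, (∃ u, G.Adj v u) →
    ∃ u, G.Adj v u ∧ ∀ w, G.Adj v w → f w = f u → w = u

/-- `mad(G) ≤ q` : every nonempty subgraph has average degree at most `q`. -/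
def MadLE {V : Type*} (G : SimpleGraph V) (q : ℚ) : Prop :=
  ∀ H : G.Subgraph, H.verts.Nonempty →
    (2 * H.edgeSet.ncard : ℚ) ≤ q * H.verts.ncard

def MadLT {V : Type*} (G : SimpleGraph V) (q : ℚ) : Prop :=
  ∀ H : G.Subgraph, H.verts.Nonempty →
    (2 * H.edgeSet.ncard : ℚ) < q * H.verts.ncard

/-- `G` contains a copy of `H` as a (not necessarily induced) subgraph. -/
def ContainsSubgraph {V W : Type*} (G : SimpleGraph V) (H : SimpleGraph W) : Prop :=
  ∃ f : W → V, Function.Injective f ∧ ∀ ⦃a b : W⦄, H.Adj a b → G.Adj (f a) (f b)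

/-- The 1-subdivision of a graph: subdivide every edge exactly once. -/
def Subdiv {V : Type*} (G : SimpleGraph V) : SimpleGraph (V ⊕ G.edgeSet) :=
  SimpleGraph.fromRel (fun a b =>
    match a, b with
    | Sum.inl v, Sum.inr e => v ∈ (e : Sym2 V)
    | _, _ => False)

/-- `K*_n`, the 1-subdivision of the complete graph on `n` vertices. -/
def KStarGraph (n : ℕ) : SimpleGraph (Fin n ⊕ (completeGraph (Fin n)).edgeSet) :=
  Subdiv (completeGraph (Fin n))

/-- `G` is `c`-PCF-critical: `G` has no PCF `c`-coloring, but every proper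
subgraph of `G` has one. -/
def PCFCritical {V : Type*} (G : SimpleGraph V) (c : ℕ) : Prop :=
  (¬ ∃ f : V → Fin c, IsPCFColoring G f) ∧
  ∀ H : G.Subgraph, H ≠ ⊤ → ∃ f : H.verts → Fin c, IsPCFColoring H.coe f

/-- `n_d(v)`: the number of neighbors of `v` having degree exactly `d`. -/
noncomputable def nDeg {V : Type*} [Fintype V] (G : SimpleGraph V) [DecidableRel G.Adj]
    (v : V) (d : ℕ) : ℕ :=
  {u | G.Adj v u ∧ G.degree u = d}.ncard

/-- `n_{d+}(v)`: the number of neighbors of `v` having degree at least `d`. -/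
noncomputable def nDegGE {V : Type*} [Fintype V] (G : SimpleGraph V) [DecidableRel G.Adj]
    (v : V) (d : ℕ) : ℕ :=
  {u | G.Adj v u ∧ d ≤ G.degree u}.ncard

/-- The coloring `f` is proper on the edges inside `S`. -/
def ProperOn {V : Type*} {c : ℕ} (G : SimpleGraph V) (f : V → Fin c) (S : Set V) : Prop :=
  ∀ ⦃a b : V⦄, a ∈ S → b ∈ S → G.Adj a b → f a ≠ f b

/-- If `z` has a neighbor in `S`, then some color appears exactly once on the neighbors of `z`
in `S`. -/
def ConflictFreeAt {V : Type*} {c : ℕ} (G : SimpleGraph V) (f : V → Fin c) (S : Set V)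
    (z : V) : Prop :=
  (∃ u ∈ S, G.Adj z u) → ∃ u ∈ S, G.Adj z u ∧ ∀ w ∈ S, G.Adj z w → f w = f u → w = u

section Extension

variable {V : Type*} {c : ℕ} {G : SimpleGraph V}

/-- A critical graph has a coloring of each proper induced subgraph. -/
lemma PCFCritical.exists_coloring_on [NeZero c] (hG : PCFCritical G c) {S : Set V}
    (hS : S ≠ Set.univ) :
    ∃ f : V → Fin c, ProperOn G f S ∧ ∀ z ∈ S, ConflictFreeAt G f S z := by
  classical
  obtain ⟨f₀, hp, hcf⟩ := hG.2 ((⊤ : G.Subgraph).induce S) (by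
    intro h
    apply hS
    have := congrArg Subgraph.verts h
    simpa using this)
  refine ⟨fun z => if h : z ∈ S then f₀ ⟨z, h⟩ else 0, ?_, ?_⟩
  · intro a b ha hb hab
    simp only [ha, hb, dif_pos]
    exact hp (u := ⟨a, ha⟩) (v := ⟨b, hb⟩) (by simp [ha, hb, hab])
  · rintro z hz ⟨u, hu, hzu⟩
    obtain ⟨⟨u', hu'⟩, had, huniq⟩ := hcf ⟨z, hz⟩ ⟨⟨u, hu⟩, by simp [hz, hu, hzu]⟩
    have hu'S : u' ∈ S := hu'
    refine ⟨u', hu'S, by simpa [hz, hu'S] using had, ?_⟩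
    intro w hw hzw hfw
    simp only [hw, hu'S, dif_pos] at hfw
    exact congrArg Subtype.val (huniq ⟨w, hw⟩ (by simp [hz, hw, hzw]) hfw)

lemma ConflictFreeAt.insert_of_not_adj [DecidableEq V] {f : V → Fin c} {S : Set V} {a z : V}
    (h : ConflictFreeAt G f S z) (ha : a ∉ S) (hza : ¬ G.Adj z a) (k : Fin c) :
    ConflictFreeAt G (Function.update f a k) (insert a S) z := by
  rintro ⟨u, hu, hzu⟩
  have mem {w : V} (hw : w ∈ insert a S) (hzw : G.Adj z w) : w ∈ S ∧ w ≠ a := by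
    rcases hw with rfl | hw
    · exact absurd hzw hza
    · exact ⟨hw, fun h => ha (h ▸ hw)⟩
  obtain ⟨u', hu', hzu', huniq⟩ := h ⟨u, (mem hu hzu).1, hzu⟩
  have hne : u' ≠ a := (mem (Or.inr hu') hzu').2
  refine ⟨u', Or.inr hu', hzu', fun w hw hzw hfw => ?_⟩
  have := mem hw hzw
  simp only [Function.update_of_ne this.2, Function.update_of_ne hne] at hfw
  exact huniq w this.1 hzw hfw

/-- At a conflict-free vertex, coloring one more vertex does no harm unless it gets one
specific color. -/
lemma exists_forbidden_color [NeZero c] [DecidableEq V] (f : V → Fin c) (S : Set V) (z : V) :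
    ∃ k₀ : Fin c, ConflictFreeAt G f S z → ∀ a ∉ S, ∀ k ≠ k₀,
      ConflictFreeAt G (Function.update f a k) (insert a S) z := by
  by_cases hn : ∃ u ∈ S, G.Adj z u
  · by_cases hcf : ConflictFreeAt G f S z
    · obtain ⟨u, hu, hzu, huniq⟩ := hcf hn
      refine ⟨f u, fun _ a ha k hk _ => ⟨u, Or.inr hu, hzu, ?_⟩⟩
      have hne : u ≠ a := fun h => ha (h ▸ hu)
      rintro w (rfl | hw) hzw hfw
      · simp only [Function.update_self, Function.update_of_ne hne] at hfw
        exact absurd hfw hk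
      · have hwa : w ≠ a := fun h => ha (h ▸ hw)
        simp only [Function.update_of_ne hwa, Function.update_of_ne hne] at hfw
        exact huniq w hw hzw hfw
    · exact ⟨0, fun h => absurd h hcf⟩
  · refine ⟨0, fun _ a _ k _ => ?_⟩
    have only {w : V} (hw : w ∈ insert a S) (hzw : G.Adj z w) : w = a :=
      hw.resolve_right fun h => hn ⟨w, h, hzw⟩
    rintro ⟨u, hu, hzu⟩
    exact ⟨u, hu, hzu, fun w hw hzw _ => (only hw hzw).trans (only hu hzu).symm⟩

/-- A vertex with at most `m` colored neighbors becomes conflict-free when a further neighbor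
is colored outside a set of at most `max 1 (m / 2)` colors. -/
lemma exists_forbidden_colors_of_card_le [NeZero c] [DecidableEq V] (f : V → Fin c) (S : Set V)
    (z : V) (T : Finset V) (hT : ∀ u, u ∈ T ↔ u ∈ S ∧ G.Adj z u) :
    ∃ K : Finset (Fin c), K.card ≤ max 1 (T.card / 2) ∧ ∀ a ∉ S, G.Adj z a → ∀ k ∉ K,
      ConflictFreeAt G (Function.update f a k) (insert a S) z := by
  by_cases hcf : ConflictFreeAt G f S z
  · obtain ⟨k₀, hk₀⟩ := exists_forbidden_color (G := G) f S z
    exact ⟨{k₀}, by simp, fun a ha _ k hk => hk₀ hcf a ha k (by simpa using hk)⟩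
  · refine ⟨T.image f, le_max_of_le_right ?_, ?_⟩
    · have h2 : (T.image f).card * 2 ≤ T.card := by
        rw [ConflictFreeAt] at hcf
        push Not at hcf
        rw [Finset.card_eq_sum_card_image f T, ← smul_eq_mul]
        refine Finset.card_nsmul_le_sum _ _ _ fun b hb => ?_
        obtain ⟨u, huT, rfl⟩ := Finset.mem_image.1 hb
        have hu := (hT u).1 huT
        obtain ⟨w, hw, hzw, hfw, hne⟩ := hcf.2 u hu.1 hu.2
        exact Finset.one_lt_card.2 ⟨w, by simp [hT, hw, hzw, hfw], u, by simp [huT], hne⟩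
      omega
    · intro a ha hza k hk _
      refine ⟨a, Or.inl rfl, hza, ?_⟩
      rintro w (rfl | hw) hzw hfw
      · rfl
      · have hwa : w ≠ a := fun h => ha (h ▸ hw)
        simp only [Function.update_of_ne hwa, Function.update_self] at hfw
        exact absurd (Finset.mem_image.2 ⟨w, (hT w).2 ⟨hw, hzw⟩, hfw⟩) hk

lemma ProperOn.insert_update [DecidableEq V] {f : V → Fin c} {S : Set V} {a : V} {k : Fin c}
    (h : ProperOn G f S) (ha : a ∉ S) (hk : ∀ u ∈ S, G.Adj a u → f u ≠ k) :
    ProperOn G (Function.update f a k) (insert a S) := by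
  have ne {w : V} (hw : w ∈ S) : w ≠ a := fun h => ha (h ▸ hw)
  rintro u w (rfl | hu) (rfl | hw) huw
  · exact absurd huw (G.irrefl)
  · simpa [Function.update_of_ne (ne hw)] using (hk w hw huw).symm
  · simpa [Function.update_of_ne (ne hu)] using hk u hu huw.symm
  · simpa [Function.update_of_ne (ne hu), Function.update_of_ne (ne hw)] using h hu hw huw

lemma exists_color_not_mem {K : Finset (Fin c)} (hK : K.card < c) : ∃ k, k ∉ K := by
  by_contra! h
  have : K = Finset.univ := Finset.eq_univ_iff_forall.2 h
  simp [this] at hK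

/-- A vertex `a` whose neighbors are `v` and `x` can be colored, keeping conflict-freeness on
`Z`, as long as `v` itself forbids fewer than `c - 3` colors. -/
lemma exists_extension_two_neighbors [NeZero c] [DecidableEq V] {f : V → Fin c} {S Z : Set V}
    {a v x : V} (hp : ProperOn G f S) (hZ : ∀ z ∈ Z, z ≠ v → ConflictFreeAt G f S z)
    (ha : a ∉ S) (hadj : ∀ u, G.Adj a u ↔ u = v ∨ u = x) {K : Finset (Fin c)}
    (hK : K.card + 3 < c)
    (hv : ∀ k ∉ K, ConflictFreeAt G (Function.update f a k) (insert a S) v) :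
    ∃ k, ProperOn G (Function.update f a k) (insert a S) ∧
      ∀ z ∈ Z, ConflictFreeAt G (Function.update f a k) (insert a S) z := by
  obtain ⟨k₀, hk₀⟩ := exists_forbidden_color (G := G) f S x
  obtain ⟨k, hk⟩ := exists_color_not_mem (K := insert (f v) (insert (f x) (insert k₀ K))) (by
    have h1 := Finset.card_insert_le (f v) (insert (f x) (insert k₀ K))
    have h2 := Finset.card_insert_le (f x) (insert k₀ K)
    have h3 := Finset.card_insert_le k₀ K
    omega)
  simp only [Finset.mem_insert, not_or] at hk
  obtain ⟨hkv, hkx, hk0, hkK⟩ := hk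
  refine ⟨k, hp.insert_update ha ?_, ?_⟩
  · intro u _ hau
    rcases (hadj u).1 hau with rfl | rfl
    · exact Ne.symm hkv
    · exact Ne.symm hkx
  · intro z hz
    by_cases hzv : z = v
    · exact hzv ▸ hv k hkK
    by_cases hzx : z = x
    · exact hzx ▸ hk₀ (hzx ▸ hZ z hz hzv) a ha k hk0
    · exact (hZ z hz hzv).insert_of_not_adj ha
        (fun h => ((hadj z).1 h.symm).elim hzv hzx) k

end Extension

section Degrees

variable {V : Type*} [Fintype V] {G : SimpleGraph V} [DecidableRel G.Adj]

lemma exists_adj_iff_of_degree_two {v w : V} (hvw : G.Adj v w) (hw : G.degree w = 2) :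
    ∃ x, x ≠ v ∧ ∀ u, G.Adj w u ↔ u = v ∨ u = x := by
  classical
  have hmem : v ∈ G.neighborFinset w := by simpa using hvw.symm
  obtain ⟨x, hx⟩ := Finset.card_eq_one.1 (show ((G.neighborFinset w).erase v).card = 1 by
    rw [Finset.card_erase_of_mem hmem, card_neighborFinset_eq_degree, hw])
  have key (u : V) : u ∈ (G.neighborFinset w).erase v ↔ u = x := by simp [hx]
  simp only [Finset.mem_erase, mem_neighborFinset] at key
  refine ⟨x, ((key x).2 rfl).1, fun u => ?_⟩
  by_cases huv : u = v
  · simp [huv, hvw.symm]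
  · simpa [huv] using key u

lemma exists_adj_iff_of_degree_three {v w : V} (hvw : G.Adj v w) (hw : G.degree w = 3) :
    ∃ x y, x ≠ v ∧ y ≠ v ∧ x ≠ y ∧ ∀ u, G.Adj w u ↔ u = v ∨ u = x ∨ u = y := by
  classical
  have hmem : v ∈ G.neighborFinset w := by simpa using hvw.symm
  obtain ⟨x, y, hxy, hx⟩ := Finset.card_eq_two.1
    (show ((G.neighborFinset w).erase v).card = 2 by
      rw [Finset.card_erase_of_mem hmem, card_neighborFinset_eq_degree, hw])
  have key (u : V) : u ∈ (G.neighborFinset w).erase v ↔ u = x ∨ u = y := by simp [hx]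
  simp only [Finset.mem_erase, mem_neighborFinset] at key
  refine ⟨x, y, ((key x).2 (Or.inl rfl)).1, ((key y).2 (Or.inr rfl)).1, hxy, fun u => ?_⟩
  by_cases huv : u = v
  · simp [huv, hvw.symm]
  · simpa [huv] using key u

end Degrees

/-- Three neighbors that do not all share one color exhibit a color used exactly once. -/
lemma conflictFreeAt_univ_of_three {V : Type*} {c : ℕ} {G : SimpleGraph V} {f : V → Fin c}
    {w p q r : V} (hadj : ∀ u, G.Adj w u ↔ u = p ∨ u = q ∨ u = r)
    (hf : ¬ (f p = f q ∧ f p = f r)) : ConflictFreeAt G f Set.univ w := by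
  intro _
  by_cases hpq : f p = f q
  · have hpr : f p ≠ f r := fun h => hf ⟨hpq, h⟩
    exact ⟨r, trivial, by simp [hadj], fun u _ hu h => by grind⟩
  · by_cases hpr : f p = f r
    · exact ⟨q, trivial, by simp [hadj], fun u _ hu h => by grind⟩
    · exact ⟨p, trivial, by simp [hadj], fun u _ hu h => by grind⟩

/-- For `c ≥ 7`, if `v` is a vertex of a `c`-PCF-critical graph with a
`2`-neighbor, then `2·deg(v) ≥ n₂(v) + n₃(v) + c`. -/
theorem two_neighbor_degree_bound' {c : ℕ} (hc : 7 ≤ c) {V : Type*} [Fintype V]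
    (G : SimpleGraph V) [DecidableRel G.Adj] (hG : PCFCritical G c)
    (v : V) (hv : ∃ u, G.Adj v u ∧ G.degree u = 2) :
    nDeg G v 2 + nDeg G v 3 + c ≤ 2 * G.degree v := by
  classical
  have : NeZero c := ⟨by omega⟩
  by_contra! hlt
  set N := G.neighborFinset v with hN
  set N₂ := N.filter (fun u => G.degree u = 2) with hN₂
  set N₃ := N.filter (fun u => G.degree u = 3) with hN₃
  have mem₂ (u : V) : u ∈ N₂ ↔ G.Adj v u ∧ G.degree u = 2 := by simp [hN₂, hN]
  have mem₃ (u : V) : u ∈ N₃ ↔ G.Adj v u ∧ G.degree u = 3 := by simp [hN₃, hN]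
  have hn₂ : nDeg G v 2 = N₂.card := by
    rw [nDeg, ← Set.ncard_coe_finset]; congr 1; ext u; simp [mem₂]
  have hn₃ : nDeg G v 3 = N₃.card := by
    rw [nDeg, ← Set.ncard_coe_finset]; congr 1; ext u; simp [mem₃]
  have hNcard : N.card = G.degree v := G.card_neighborFinset_eq_degree v
  have hsub₂ : N₂ ⊆ N := Finset.filter_subset _ _
  have hcard₂ : (N \ N₂).card + N₂.card = N.card := Finset.card_sdiff_add_card_eq_card hsub₂
  have hsub₃ : N₃ ⊆ N \ N₂ := by
    intro u hu
    have h := (mem₃ u).1 hu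
    have h2 : u ∉ N₂ := fun h' => by have := ((mem₂ u).1 h').2; omega
    simp [hN, h.1, h2]
  have hcard₃ : ((N \ N₂) \ N₃).card + N₃.card = (N \ N₂).card :=
    Finset.card_sdiff_add_card_eq_card hsub₃
  obtain ⟨w₁, hw₁⟩ := hv
  have hw₁N : w₁ ∈ N₂ := (mem₂ w₁).2 hw₁
  have hpos : 0 < N₂.card := Finset.card_pos.2 ⟨w₁, hw₁N⟩
  have hvN₂ : v ∉ N₂ := fun h => G.irrefl ((mem₂ v).1 h).1
  -- color everything but `v` and its neighbors of degree two
  set S : Set V := {z | z ≠ v ∧ z ∉ N₂} with hS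
  have hvS : v ∉ S := fun h => h.1 rfl
  obtain ⟨f, hfp, hfcf⟩ := hG.exists_coloring_on (S := S) (fun h => hvS (h ▸ trivial))
  choose! x hxv hx using fun w (hw : w ∈ N₂) =>
    exists_adj_iff_of_degree_two ((mem₂ w).1 hw).1 ((mem₂ w).1 hw).2
  choose g hg using exists_forbidden_color (G := G) f S
  -- color `v`
  obtain ⟨k, hk⟩ := exists_color_not_mem
    (K := (N \ N₂).image f ∪ (((N \ N₂) \ N₃).image g ∪ N₂.image (f ∘ x))) (by
      have h1 := Finset.card_union_le ((N \ N₂).image f)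
        (((N \ N₂) \ N₃).image g ∪ N₂.image (f ∘ x))
      have h2 := Finset.card_union_le (((N \ N₂) \ N₃).image g) (N₂.image (f ∘ x))
      have h3 := Finset.card_image_le (s := N \ N₂) (f := f)
      have h4 := Finset.card_image_le (s := (N \ N₂) \ N₃) (f := g)
      have h5 := Finset.card_image_le (s := N₂) (f := f ∘ x)
      omega)
  simp only [Finset.mem_union, not_or] at hk
  obtain ⟨hkf, hkg, hkx⟩ := hk
  set f₁ := Function.update f v k with hf₁
  set S₁ : Set V := insert v S with hS₁
  set Z : Set V := {z | z ∉ N₂ ∧ z ∉ N₃} with hZ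
  have memS₁ (z : V) : z ∈ S₁ ↔ z ∉ N₂ := by
    by_cases hzv : z = v
    · simp [hS₁, hzv, hvN₂]
    · simp [hS₁, hS, hzv]
  have hp₁ : ProperOn G f₁ S₁ := by
    refine hfp.insert_update hvS fun u hu hvu h => hkf ?_
    exact Finset.mem_image.2 ⟨u, by simp [hN, hvu, hu.2], h⟩
  have hcf₁ : ∀ z ∈ Z, z ≠ v → ConflictFreeAt G f₁ S₁ z := by
    rintro z ⟨hz₂, hz₃⟩ hzv
    have hzS : z ∈ S := ⟨hzv, hz₂⟩
    by_cases hadj : G.Adj v z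
    · refine hg z (hfcf z hzS) v hvS k fun h => hkg ?_
      exact Finset.mem_image.2 ⟨z, by simp [hN, hadj, hz₂, hz₃], h.symm⟩
    · exact (hfcf z hzS).insert_of_not_adj hvS (fun h => hadj h.symm) k
  -- color the neighbors of degree two, starting with one that makes `v` conflict-free
  have extend : ∀ T : Finset V, T ⊆ N₂.erase w₁ → ∃ f' : V → Fin c, (∀ z ∉ N₂, f' z = f₁ z) ∧
      ProperOn G f' (insert w₁ (S₁ ∪ T)) ∧
        ∀ z ∈ Z, ConflictFreeAt G f' (insert w₁ (S₁ ∪ T)) z := by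
    intro T
    induction T using Finset.induction_on with
    | empty =>
      intro _
      have hw₁S : w₁ ∉ S₁ := fun h => (memS₁ w₁).1 h hw₁N
      obtain ⟨K, hKcard, hK⟩ := exists_forbidden_colors_of_card_le (G := G) f₁ S₁ v (N \ N₂)
        (fun u => by rw [memS₁]; simp [hN, and_comm])
      obtain ⟨l, hl⟩ := exists_extension_two_neighbors hp₁ hcf₁ hw₁S (hx w₁ hw₁N) (K := K)
        (by omega) (hK w₁ hw₁S hw₁.1)
      refine ⟨Function.update f₁ w₁ l, fun z hz => ?_, by simpa using hl⟩
      exact Function.update_of_ne (fun h : z = w₁ => hz (h ▸ hw₁N)) _ _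
    | insert a T haT ih =>
      intro hT
      obtain ⟨f', hf', hp', hcf'⟩ := ih ((Finset.subset_insert _ _).trans hT)
      obtain ⟨haw, haN⟩ := Finset.mem_erase.1 (hT (Finset.mem_insert_self a T))
      have haS : a ∉ insert w₁ (S₁ ∪ (T : Set V)) := by
        simp [haw, haT, memS₁, haN]
      have hvZ : v ∈ Z := ⟨hvN₂, fun h => G.irrefl ((mem₃ v).1 h).1⟩
      obtain ⟨k₀, hk₀⟩ := exists_forbidden_color (G := G) f' (insert w₁ (S₁ ∪ (T : Set V))) v
      obtain ⟨l, hl⟩ := exists_extension_two_neighbors hp' (fun z hz _ => hcf' z hz) haS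
        (hx a haN) (K := {k₀}) (by simp; omega)
        (fun k hk => hk₀ (hcf' v hvZ) a haS k (by simpa using hk))
      refine ⟨Function.update f' a l, fun z hz => ?_, ?_⟩
      · rw [Function.update_of_ne (fun h : z = a => hz (h ▸ haN)), hf' z hz]
      · have : insert w₁ (S₁ ∪ ((insert a T : Finset V) : Set V))
            = insert a (insert w₁ (S₁ ∪ (T : Set V))) := by
          rw [Finset.coe_insert, Set.union_insert, Set.insert_comm]
        rwa [this]
  obtain ⟨f', hf', hp', hcf'⟩ := extend _ subset_rfl
  have huniv : insert w₁ (S₁ ∪ ((N₂.erase w₁ : Finset V) : Set V)) = Set.univ := by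
    refine Set.eq_univ_of_forall fun z => ?_
    by_cases hzw : z = w₁
    · exact Or.inl hzw
    by_cases hz : z ∈ N₂
    · exact Or.inr (Or.inr (Finset.mem_coe.2 (Finset.mem_erase.2 ⟨hzw, hz⟩)))
    · exact Or.inr (Or.inl ((memS₁ z).2 hz))
  rw [huniv] at hp' hcf'
  have hf'S {z : V} (hzv : z ≠ v) (hz : z ∉ N₂) : f' z = f z := by
    rw [hf' z hz, hf₁, Function.update_of_ne hzv]
  have hf'v : f' v = k := by rw [hf' v hvN₂, hf₁, Function.update_self]
  have hne {u : V} (hu : u ∈ N₂) : f' v ≠ f' u := hp' trivial trivial ((mem₂ u).1 hu).1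
  have hall : ∀ z, ConflictFreeAt G f' Set.univ z := by
    intro z
    by_cases hz₂ : z ∈ N₂
    · have hvx : f' v ≠ f' (x z) := by
        by_cases hxz : x z ∈ N₂
        · exact hne hxz
        · rw [hf'v, hf'S (hxv z hz₂) hxz]
          exact fun h => hkx (Finset.mem_image.2 ⟨z, hz₂, h.symm⟩)
      exact conflictFreeAt_univ_of_three (p := v) (q := x z) (r := x z)
        (fun u => by rw [hx z hz₂ u, or_self]) (fun h => hvx h.1)
    by_cases hz₃ : z ∈ N₃
    · obtain ⟨hvz, hdeg⟩ := (mem₃ z).1 hz₃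
      obtain ⟨a, b, hav, hbv, hab, hadj⟩ := exists_adj_iff_of_degree_three hvz hdeg
      refine conflictFreeAt_univ_of_three hadj fun h => ?_
      by_cases ha : a ∈ N₂
      · exact hne ha h.1
      by_cases hb : b ∈ N₂
      · exact hne hb h.2
      have hfab : f a = f b := by
        rw [← hf'S hav ha, ← hf'S hbv hb, ← h.1, ← h.2]
      obtain ⟨u, hu, hzu, huniq⟩ := hfcf z ⟨hvz.ne', hz₂⟩ ⟨a, ⟨hav, ha⟩, by simp [hadj]⟩
      have ha' := huniq a ⟨hav, ha⟩ (by simp [hadj])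
      have hb' := huniq b ⟨hbv, hb⟩ (by simp [hadj])
      rcases (hadj u).1 hzu with rfl | rfl | rfl
      · exact hu.1 rfl
      · exact hab (hb' hfab.symm).symm
      · exact hab (ha' hfab)
    · exact hcf' z ⟨hz₂, hz₃⟩
  refine hG.1 ⟨f', fun a b hab => hp' trivial trivial hab, fun z ⟨u, hu⟩ => ?_⟩
  obtain ⟨u', _, hzu', huniq⟩ := hall z ⟨u, trivial, hu⟩
  exact ⟨u', hzu', fun w hzw => huniq w trivial hzw⟩
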